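/- Let A be an algebra, S and T tolerances on A, and δ a congruence on A. If T ∩ (S∘(T∩δ)∘S) ⊆ δ, then C(S,T;δ) holds. -/

import Mathlib

open FirstOrder.Language FirstOrder.Language.Structure

universe u v w

/-- A binary relation on `A` is compatible with all (interpreted) operations of the
`L`-structure `A`. -/
def Compatible (L : FirstOrder.Language.{u, v}) (A : Type w) [L.Structure A]
    (T : A → A → Prop) : Prop :=
  ∀ (n : ℕ) (f : L.Functions n) (a b : Fin n → A),
    (∀ i, T (a i) (b i)) → T (funMap f a) (funMap f b)

/-- A tolerance on `A`: a reflexive, symmetric, compatible binary relation. -/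
def IsTolerance (L : FirstOrder.Language.{u, v}) (A : Type w) [L.Structure A]
    (T : A → A → Prop) : Prop :=
  Reflexive T ∧ Symmetric T ∧ Compatible L A T

/-- A congruence on `A`: a transitive tolerance. -/
def IsCongruence (L : FirstOrder.Language.{u, v}) (A : Type w) [L.Structure A]
    (T : A → A → Prop) : Prop :=
  IsTolerance L A T ∧ Transitive T

/-- The centralizer condition `C(S, T; δ)`: for every term `t(x, y₁, …, yₙ)`
(variable `0` playing the role of `x`), every `(a, b) ∈ S` and all pairs
`(uᵢ, vᵢ) ∈ T`, if `(t(a, ū), t(a, v̄)) ∈ δ` then `(t(b, ū), t(b, v̄)) ∈ δ`. -/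
def Centralizes (L : FirstOrder.Language.{u, v}) (A : Type w) [L.Structure A]
    (S T δ : A → A → Prop) : Prop :=
  ∀ (n : ℕ) (t : L.Term (Fin (n + 1))) (a b : A), S a b →
    ∀ u v : Fin n → A, (∀ i, T (u i) (v i)) →
      (δ (t.realize (Fin.cons a u)) (t.realize (Fin.cons a v)) →
        δ (t.realize (Fin.cons b u)) (t.realize (Fin.cons b v)))

/-- Composition of binary relations: `(a, c) ∈ R ∘ S` iff there is `b` with
`(a, b) ∈ R` and `(b, c) ∈ S`. -/
def RelComp {A : Type w} (R S : A → A → Prop) : A → A → Prop :=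
  fun a c => ∃ b, R a b ∧ S b c

/-- A compatible relation is preserved by every term operation. -/
theorem Compatible.realize {L : FirstOrder.Language.{u, v}} {A : Type w} [L.Structure A]
    {T : A → A → Prop} (hT : Compatible L A T) {α : Type*} (t : L.Term α) {x y : α → A}
    (hxy : ∀ i, T (x i) (y i)) : T (t.realize x) (t.realize y) := by
  induction t with
  | var i => exact hxy i
  | func f ts ih => exact hT _ f _ _ ih

/-- Theorem 2.19 (7): if `T ∩ (S ∘ (T ∩ δ) ∘ S) ⊆ δ`, then `C(S, T; δ)` holds. -/
theorem centralizes_of_comp_subset {L : FirstOrder.Language.{u, v}}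
    {A : Type w} [L.Structure A] (S T δ : A → A → Prop)
    (hS : IsTolerance L A S) (hT : IsTolerance L A T) (hδ : IsCongruence L A δ)
    (h : ∀ a b : A, T a b →
      RelComp (RelComp S (fun x y => T x y ∧ δ x y)) S a b → δ a b) :
    Centralizes L A S T δ := by
  obtain ⟨hSr, hSs, hSc⟩ := hS
  obtain ⟨hTr, -, hTc⟩ := hT
  intro n t a b hab u v huv hδa
  have hT_cons : ∀ c : A, T (t.realize (Fin.cons c u)) (t.realize (Fin.cons c v)) :=
    fun c => hTc.realize t (Fin.cases (hTr c) huv)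
  have hS_cons : ∀ w : Fin n → A, S (t.realize (Fin.cons a w)) (t.realize (Fin.cons b w)) :=
    fun w => hSc.realize t (Fin.cases hab fun i => hSr (w i))
  exact h _ _ (hT_cons b) ⟨_, ⟨_, hSs (hS_cons u), hT_cons a, hδa⟩, hS_cons v⟩
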